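/- For fixed k ≥ 1 and n ≥ k+1, the counts A_{2n}^{=n+k} = |{σ ∈ UD_{2n} : mmp^{(1,0,0,0)}(σ) = n+k}| satisfy the recursion A_{2n}^{=n+k} = Σ_{j=1}^{k+1} C(2n-1, 2j-1) · B_{2j-1}(1) · A_{2(n-j)}^{=(n-j)+k-j+1}, where B_{2j-1}(1) = |UD_{2j-1}| and A_0^{=0} = 1. -/

import Mathlib

open Finset

/-- Number of indices `i` such that there exists `j > i` with `σ j > σ i`
    (the statistic mmp^{(1,0,0,0)}). -/
noncomputable def mmp1000 {n : ℕ} (σ : Equiv.Perm (Fin n)) : ℕ :=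
  (Finset.univ.filter (fun i : Fin n => ∃ j : Fin n, i < j ∧ σ i < σ j)).card

/-- Number of indices `i` such that there exists `j < i` with `σ j > σ i`
    (the statistic mmp^{(0,1,0,0)}). -/
noncomputable def mmp0100 {n : ℕ} (σ : Equiv.Perm (Fin n)) : ℕ :=
  (Finset.univ.filter (fun i : Fin n => ∃ j : Fin n, j < i ∧ σ i < σ j)).card

/-- Number of indices `i` such that there exists `j > i` with `σ j < σ i`
    (the statistic mmp^{(0,0,0,1)}). -/
noncomputable def mmp0001 {n : ℕ} (σ : Equiv.Perm (Fin n)) : ℕ :=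
  (Finset.univ.filter (fun i : Fin n => ∃ j : Fin n, i < j ∧ σ j < σ i)).card

/-- σ is up-down: σ(1) < σ(2) > σ(3) < σ(4) > ⋯ (0-indexed: ascent at even indices). -/
def IsUpDown {n : ℕ} (σ : Equiv.Perm (Fin n)) : Prop :=
  ∀ i : Fin n, ∀ h : (i : ℕ) + 1 < n,
    if (i : ℕ) % 2 = 0 then σ i < σ ⟨(i : ℕ) + 1, h⟩ else σ ⟨(i : ℕ) + 1, h⟩ < σ i

/-- σ is down-up: σ(1) > σ(2) < σ(3) > σ(4) < ⋯ (0-indexed: descent at even indices). -/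
def IsDownUp {n : ℕ} (σ : Equiv.Perm (Fin n)) : Prop :=
  ∀ i : Fin n, ∀ h : (i : ℕ) + 1 < n,
    if (i : ℕ) % 2 = 0 then σ ⟨(i : ℕ) + 1, h⟩ < σ i else σ i < σ ⟨(i : ℕ) + 1, h⟩

open scoped Classical in
/-- The set of up-down permutations of length `m`. -/
noncomputable def UDset (m : ℕ) : Finset (Equiv.Perm (Fin m)) :=
  Finset.univ.filter (fun σ => IsUpDown σ)

open scoped Classical in
/-- The set of down-up permutations of length `m`. -/
noncomputable def DUset (m : ℕ) : Finset (Equiv.Perm (Fin m)) :=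
  Finset.univ.filter (fun σ => IsDownUp σ)

/-- The reverse of σ: σ^r(i) = σ(n+1-i). -/
def permReverse {n : ℕ} (σ : Equiv.Perm (Fin n)) : Equiv.Perm (Fin n) :=
  Fin.revPerm.trans σ

/-- The complement of σ: σ^c(i) = n+1-σ(i). -/
def permComplement {n : ℕ} (σ : Equiv.Perm (Fin n)) : Equiv.Perm (Fin n) :=
  σ.trans Fin.revPerm

/-- A_{2n}(x) = Σ_{σ ∈ UD_{2n}} x^{mmp^{(1,0,0,0)}(σ)}. -/
noncomputable def Apoly (n : ℕ) (x : ℤ) : ℤ :=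
  ∑ σ ∈ UDset (2 * n), x ^ mmp1000 σ

/-- B_{2n+1}(x) = Σ_{σ ∈ UD_{2n+1}} x^{mmp^{(1,0,0,0)}(σ)}. -/
noncomputable def Bpoly (n : ℕ) (x : ℤ) : ℤ :=
  ∑ σ ∈ UDset (2 * n + 1), x ^ mmp1000 σ

/-- C_{2n}(x) = Σ_{σ ∈ DU_{2n}} x^{mmp^{(1,0,0,0)}(σ)}. -/
noncomputable def Cpoly (n : ℕ) (x : ℤ) : ℤ :=
  ∑ σ ∈ DUset (2 * n), x ^ mmp1000 σ

/-- D_{2n+1}(x) = Σ_{σ ∈ DU_{2n+1}} x^{mmp^{(1,0,0,0)}(σ)}. -/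
noncomputable def Dpoly (n : ℕ) (x : ℤ) : ℤ :=
  ∑ σ ∈ DUset (2 * n + 1), x ^ mmp1000 σ

/-- Number of up-down permutations of length m. -/
noncomputable def udCount (m : ℕ) : ℕ := (UDset m).card

/-- Number of down-up permutations of length m. -/
noncomputable def duCount (m : ℕ) : ℕ := (DUset m).card

open scoped Classical in
/-- |{σ ∈ UD_{2m} : mmp^{(1,0,0,0)}(σ) = c}|. -/
noncomputable def AcountEq (m c : ℕ) : ℕ :=
  ((UDset (2 * m)).filter (fun σ => mmp1000 σ = c)).card

open scoped Classical in
/-- |{σ ∈ DU_{2m+1} : mmp^{(1,0,0,0)}(σ) = c}|. -/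
noncomputable def DcountEq (m c : ℕ) : ℕ :=
  ((DUset (2 * m + 1)).filter (fun σ => mmp1000 σ = c)).card

open scoped Classical in
/-- |{σ ∈ UD_{2m+1} : mmp^{(1,0,0,0)}(σ) = c}|. -/
noncomputable def BcountEq (m c : ℕ) : ℕ :=
  ((UDset (2 * m + 1)).filter (fun σ => mmp1000 σ = c)).card

open scoped Classical in
/-- |{σ ∈ DU_{2m} : mmp^{(1,0,0,0)}(σ) = c}|. -/
noncomputable def CcountEq (m c : ℕ) : ℕ :=
  ((DUset (2 * m)).filter (fun σ => mmp1000 σ = c)).card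

section helpers

def posFun (p q : ℕ) : Option (Fin p ⊕ Fin q) → Fin (p + q + 1)
  | none => ⟨p, by omega⟩
  | some (Sum.inl i) => ⟨i, by omega⟩
  | some (Sum.inr i) => ⟨p + 1 + i, by omega⟩

theorem posFun_bij (p q : ℕ) : Function.Bijective (posFun p q) := by
  rw [Fintype.bijective_iff_injective_and_card]
  constructor
  · rintro (_ | i | i) (_ | j | j) h <;> simp only [posFun, Fin.mk.injEq] at h
    · rfl
    · omega
    · omega
    · omega
    · congr 2; ext; exact h
    · omega
    · omega
    · omega
    · congr 2; ext; omega
  · simp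

noncomputable def posEquiv (p q : ℕ) : Option (Fin p ⊕ Fin q) ≃ Fin (p + q + 1) :=
  Equiv.ofBijective _ (posFun_bij p q)

theorem compl_card' {p q : ℕ} (S : {S : Finset (Fin (p + q)) // S.card = p}) :
    (S.1ᶜ).card = q := by
  rw [Finset.card_compl, S.2]; simp

def Gmap (p q : ℕ) (x : {S : Finset (Fin (p + q)) // S.card = p} ×
    Equiv.Perm (Fin p) × Equiv.Perm (Fin q)) : Fin p ⊕ Fin q ≃ Fin (p + q) :=
  (Equiv.sumCongr x.2.1 x.2.2).trans (finSumEquivOfFinset x.1.2 (compl_card' x.1))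

theorem Gmap_inj (p q : ℕ) : Function.Injective (Gmap p q) := by
  rintro ⟨S, τ, ρ⟩ ⟨S', τ', ρ'⟩ h
  have key : ∀ x : {S : Finset (Fin (p + q)) // S.card = p} ×
    Equiv.Perm (Fin p) × Equiv.Perm (Fin q), ∀ a, a ∈ x.1.1 ↔ ∃ i, Gmap p q x (Sum.inl i) = a := by
    rintro ⟨S, τ, ρ⟩ a
    simp only [Gmap, Equiv.trans_apply, Equiv.sumCongr_apply, Sum.map_inl,
      finSumEquivOfFinset_inl]
    have := Finset.range_orderEmbOfFin S.1 S.2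
    have h2 : a ∈ S.1 ↔ a ∈ Set.range (S.1.orderEmbOfFin S.2) := by rw [this]; simp
    rw [h2]
    constructor
    · rintro ⟨i, rfl⟩
      exact ⟨τ.symm i, by simp⟩
    · rintro ⟨i, rfl⟩
      exact ⟨_, rfl⟩
  have hS : S = S' := by
    ext a
    rw [key (S, τ, ρ) a, key (S', τ', ρ') a, h]
  subst hS
  have hh : Equiv.sumCongr τ ρ = Equiv.sumCongr τ' ρ' := by
    ext1 o
    have := congrArg (fun g => g o) h
    simpa [Gmap] using this
  have h1 : τ = τ' := by
    ext1 i
    have := congrArg (fun g => g (Sum.inl i)) hh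
    simpa using this
  have h2 : ρ = ρ' := by
    ext1 i
    have := congrArg (fun g => g (Sum.inr i)) hh
    simpa using this
  rw [h1, h2]

theorem Gmap_surj (p q : ℕ) : Function.Surjective (Gmap p q) := by
  refine ((Fintype.bijective_iff_injective_and_card _).2 ⟨Gmap_inj p q, ?_⟩).2
  rw [Fintype.card_prod, Fintype.card_prod, Fintype.card_finset_len, Fintype.card_perm,
    Fintype.card_perm, Fintype.card_equiv finSumFinEquiv]
  simp only [Fintype.card_fin, Fintype.card_sum]
  have := Nat.add_choose_mul_factorial_mul_factorial p q
  rw [← this, Nat.choose_symm_add]; ring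

noncomputable def Psi (p q : ℕ) (x : {S : Finset (Fin (p + q)) // S.card = p} ×
    Equiv.Perm (Fin p) × Equiv.Perm (Fin q)) : Equiv.Perm (Fin (p + q + 1)) :=
  (posEquiv p q).symm.trans ((Equiv.optionCongr (Gmap p q x)).trans finSuccEquivLast.symm)

theorem Psi_pos (p q : ℕ) (x) (o) : Psi p q x (posFun p q o) =
    finSuccEquivLast.symm (Equiv.optionCongr (Gmap p q x) o) := by
  have : posFun p q o = posEquiv p q o := rfl
  rw [this]; simp [Psi]

theorem Psi_inj (p q : ℕ) : Function.Injective (Psi p q) := by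
  intro x y h
  apply Gmap_inj
  apply Equiv.optionCongr_injective
  ext1 o
  have := congrArg (fun g => g (posFun p q o)) h
  simpa only [Psi_pos, EmbeddingLike.apply_eq_iff_eq] using this

theorem Psi_surj (p q : ℕ) (σ : Equiv.Perm (Fin (p + q + 1)))
    (h : σ (posFun p q none) = Fin.last _) : ∃ x, Psi p q x = σ := by
  let K : Option (Fin p ⊕ Fin q) ≃ Option (Fin (p + q)) :=
    (posEquiv p q).trans (σ.trans finSuccEquivLast)
  have hK : K none = none := by
    change finSuccEquivLast (σ (posFun p q none)) = none
    rw [h]; simp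
  obtain ⟨x, hx⟩ := Gmap_surj p q (Equiv.removeNone K)
  refine ⟨x, ?_⟩
  have hx' : Equiv.optionCongr (Gmap p q x) = K := by
    rw [hx]
    ext1 o
    rcases o with _ | o
    · simp [hK]
    · simp only [Equiv.optionCongr_apply, Option.map_some]
      apply Equiv.removeNone_some
      rw [← Option.ne_none_iff_exists']
      intro h'
      rw [← hK] at h'
      simpa using K.injective h'
  rw [Psi, hx']
  ext1 i
  simp [K]

theorem Psi_none (p q : ℕ) (x) : Psi p q x (posFun p q none) = Fin.last _ := by
  rw [Psi_pos]; simp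

theorem Psi_L (p q : ℕ) (x) (i j : Fin p) :
    Psi p q x (posFun p q (some (Sum.inl i))) < Psi p q x (posFun p q (some (Sum.inl j))) ↔
      x.2.1 i < x.2.1 j := by
  rw [Psi_pos, Psi_pos]; simp [Gmap]

theorem Psi_R (p q : ℕ) (x) (i j : Fin q) :
    Psi p q x (posFun p q (some (Sum.inr i))) < Psi p q x (posFun p q (some (Sum.inr j))) ↔
      x.2.2 i < x.2.2 j := by
  rw [Psi_pos, Psi_pos]; simp [Gmap]

theorem Psi_lt (p q : ℕ) (x) (o) :
    Psi p q x (posFun p q (some o)) < Psi p q x (posFun p q none) := by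
  rw [Psi_none, Psi_pos]; simp [Fin.castSucc_lt_last]

theorem Psi_UD (p q : ℕ) (hp : p % 2 = 1) (x) :
    IsUpDown (Psi p q x) ↔ IsUpDown x.2.1 ∧ IsUpDown x.2.2 := by
  constructor
  · intro H
    constructor
    · intro i h
      have := H (posFun p q (some (Sum.inl i))) (by simp only [posFun]; omega)
      have e : (⟨(posFun p q (some (Sum.inl i)) : ℕ) + 1, by simp only [posFun]; omega⟩ :
        Fin (p + q + 1)) = posFun p q (some (Sum.inl ⟨i + 1, h⟩)) := rfl
      rw [e, Psi_L, Psi_L] at this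
      exact this
    · intro i h
      have := H (posFun p q (some (Sum.inr i))) (by simp only [posFun]; omega)
      have e : (⟨(posFun p q (some (Sum.inr i)) : ℕ) + 1, by simp only [posFun]; omega⟩ :
        Fin (p + q + 1)) = posFun p q (some (Sum.inr ⟨i + 1, h⟩)) := rfl
      rw [e, Psi_R, Psi_R] at this
      have e2 : (posFun p q (some (Sum.inr i)) : ℕ) % 2 = (i : ℕ) % 2 := by
        simp only [posFun]; omega
      rw [e2] at this
      exact this
  · rintro ⟨H1, H2⟩ i h
    obtain ⟨o, rfl⟩ := (posFun_bij p q).2 i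
    rcases o with _ | i | i
    · have h0 : (posFun p q none : ℕ) = p := rfl
      have hq : 0 < q := by omega
      have e : (⟨(posFun p q none : ℕ) + 1, h⟩ :
        Fin (p + q + 1)) = posFun p q (some (Sum.inr ⟨0, hq⟩)) := rfl
      rw [e, if_neg (by omega)]
      exact Psi_lt ..
    · by_cases hi : (i : ℕ) + 1 < p
      · have e : (⟨(posFun p q (some (Sum.inl i)) : ℕ) + 1, h⟩ :
          Fin (p + q + 1)) = posFun p q (some (Sum.inl ⟨i + 1, hi⟩)) := rfl
        rw [e, Psi_L, Psi_L]
        exact H1 i hi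
      · have hi' : (i : ℕ) + 1 = p := by omega
        have e : (⟨(posFun p q (some (Sum.inl i)) : ℕ) + 1, h⟩ :
          Fin (p + q + 1)) = posFun p q none := by
            ext; exact hi'
        have h0 : (posFun p q (some (Sum.inl i)) : ℕ) = i := rfl
        rw [e, if_pos (by omega)]
        exact Psi_lt ..
    · have h0 : (posFun p q (some (Sum.inr i)) : ℕ) = p + 1 + i := rfl
      have hi : (i : ℕ) + 1 < q := by omega
      have e : (⟨(posFun p q (some (Sum.inr i)) : ℕ) + 1, h⟩ :
        Fin (p + q + 1)) = posFun p q (some (Sum.inr ⟨i + 1, hi⟩)) := rfl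
      have e2 : (posFun p q (some (Sum.inr i)) : ℕ) % 2 = (i : ℕ) % 2 := by omega
      rw [e, Psi_R, Psi_R, e2]
      exact H2 i hi

theorem Psi_mmp (p q : ℕ) (x) : mmp1000 (Psi p q x) = p + mmp1000 x.2.2 := by
  classical
  unfold mmp1000
  rw [Finset.card_filter, Finset.card_filter, ← (posEquiv p q).sum_comp, Fintype.sum_option,
    Fintype.sum_sum_type]
  have h1 : ¬ ∃ j, posEquiv p q none < j ∧ Psi p q x (posEquiv p q none) < Psi p q x j := by
    rintro ⟨j, -, hj⟩
    change Psi p q x (posFun p q none) < _ at hj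
    rw [Psi_none] at hj
    exact absurd (Fin.le_last _) (not_le.2 hj)
  have h2 : ∀ i, ∃ j, posEquiv p q (some (Sum.inl i)) < j ∧
      Psi p q x (posEquiv p q (some (Sum.inl i))) < Psi p q x j := by
    intro i
    refine ⟨posFun p q none, ?_, Psi_lt p q x (Sum.inl i)⟩
    have e : posEquiv p q (some (Sum.inl i)) = ⟨(i : ℕ), by omega⟩ := rfl
    have e' : posFun p q none = ⟨p, by omega⟩ := rfl
    rw [e, e', Fin.mk_lt_mk]
    exact i.2
  have h3 : ∀ i, (∃ j, posEquiv p q (some (Sum.inr i)) < j ∧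
      Psi p q x (posEquiv p q (some (Sum.inr i))) < Psi p q x j) ↔
      ∃ j, i < j ∧ x.2.2 i < x.2.2 j := by
    intro i
    constructor
    · rintro ⟨j, hj, hj'⟩
      obtain ⟨o, rfl⟩ := (posFun_bij p q).2 j
      have hj2 : p + 1 + (i : ℕ) < (posFun p q o : ℕ) := hj
      rcases o with _ | j | j
      · have : (posFun p q none : ℕ) = p := rfl
        omega
      · have : (posFun p q (some (Sum.inl j)) : ℕ) = j := rfl
        omega
      · have : (posFun p q (some (Sum.inr j)) : ℕ) = p + 1 + j := rfl
        exact ⟨j, by rw [Fin.lt_def]; omega, (Psi_R p q x i j).1 hj'⟩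
    · rintro ⟨j, hj, hj'⟩
      refine ⟨posFun p q (some (Sum.inr j)), ?_, (Psi_R p q x i j).2 hj'⟩
      change p + 1 + (i : ℕ) < p + 1 + j
      rw [Fin.lt_def] at hj; omega
  rw [if_neg h1]
  simp only [h2, h3]
  simp

open scoped Classical in
noncomputable def cnt (N c : ℕ) : ℕ :=
  ((UDset N).filter (fun σ => mmp1000 σ = c)).card

open scoped Classical in
theorem fiber_card (N p q c : ℕ) (hN : N = p + q + 1) (hp : p % 2 = 1) :
    (((UDset N).filter (fun σ => mmp1000 σ = p + c)).filter
      (fun σ => ∃ i : Fin _, (i : ℕ) = p ∧ (σ i : ℕ) + 1 = N)).card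
    = (N - 1).choose p * udCount p * cnt q c := by
  subst hN
  have : (((UDset (p + q + 1)).filter (fun σ => mmp1000 σ = p + c)).filter
      (fun σ => ∃ i : Fin _, (i : ℕ) = p ∧ (σ i : ℕ) + 1 = p + q + 1)) =
      ((Finset.univ : Finset {S : Finset (Fin (p + q)) // S.card = p}) ×ˢ
        (UDset p ×ˢ (UDset q).filter (fun σ => mmp1000 σ = c))).image (Psi p q) := by
    ext σ
    simp only [UDset, Finset.mem_filter, Finset.mem_univ, true_and, Finset.mem_image,
      Finset.mem_product]
    constructor
    · rintro ⟨⟨h1, h2⟩, i, hi, h3⟩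
      have hi' : i = posFun p q none := by ext; exact hi
      subst hi'
      obtain ⟨x, rfl⟩ := Psi_surj p q σ (by ext; simp; omega)
      rw [Psi_UD p q hp] at h1
      rw [Psi_mmp] at h2
      exact ⟨x, ⟨h1.1, h1.2, by omega⟩, rfl⟩
    · rintro ⟨x, ⟨h1, h2, h3⟩, rfl⟩
      refine ⟨⟨(Psi_UD p q hp x).2 ⟨h1, h2⟩, by rw [Psi_mmp, h3]⟩, posFun p q none, rfl, ?_⟩
      rw [Psi_none]; simp
  rw [this, Finset.card_image_of_injective _ (Psi_inj p q), Finset.card_product,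
    Finset.card_product, Finset.card_univ, Fintype.card_finset_len]
  simp [udCount, cnt, mul_assoc]

theorem mmp_ge (m : ℕ) (σ : Equiv.Perm (Fin (2 * m))) (h : IsUpDown σ) : m ≤ mmp1000 σ := by
  classical
  unfold mmp1000
  have : (Finset.univ.image (fun i : Fin m => (⟨2 * i, by omega⟩ : Fin (2 * m)))).card = m := by
    rw [Finset.card_image_of_injective, Finset.card_univ, Fintype.card_fin]
    intro a b hab
    simp only [Fin.mk.injEq] at hab
    ext; omega
  conv_lhs => rw [← this]
  apply Finset.card_le_card
  intro a ha
  simp only [Finset.mem_image, Finset.mem_univ, true_and] at ha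
  obtain ⟨i, rfl⟩ := ha
  simp only [Finset.mem_filter, Finset.mem_univ, true_and]
  have := h ⟨2 * i, by omega⟩ (by simp only; omega)
  rw [if_pos (by simp)] at this
  exact ⟨_, by rw [Fin.lt_def]; simp, this⟩

theorem max_pos (n : ℕ) (σ : Equiv.Perm (Fin (2 * n))) (h : IsUpDown σ) (i : Fin (2 * n))
    (hi : (σ i : ℕ) + 1 = 2 * n) : (i : ℕ) % 2 = 1 := by
  by_contra hc
  have h1 := h i (by omega)
  rw [if_pos (by omega), Fin.lt_def] at h1
  have := (σ ⟨i + 1, by omega⟩).2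
  omega

theorem mmp_ge_max (N p : ℕ) (σ : Equiv.Perm (Fin N)) (i : Fin N) (hp : (i : ℕ) = p)
    (hi : (σ i : ℕ) + 1 = N) : p ≤ mmp1000 σ := by
  classical
  unfold mmp1000
  have : (Finset.Iio i).card = p := by rw [Fin.card_Iio, hp]
  rw [← this]
  apply Finset.card_le_card
  intro a ha
  simp only [Finset.mem_Iio] at ha
  simp only [Finset.mem_filter, Finset.mem_univ, true_and]
  refine ⟨i, ha, ?_⟩
  have h1 : σ a ≠ σ i := fun h => ha.ne (σ.injective h)
  have h2 := (σ a).2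
  rw [Fin.lt_def]
  have h3 : (σ a : ℕ) ≠ σ i := fun h => h1 (Fin.ext h)
  omega

end helpers

theorem stmt18 (n k : ℕ) (hk : 1 ≤ k) (hn : k + 1 ≤ n) :
    AcountEq n (n + k) = ∑ j ∈ Finset.Icc 1 (k + 1),
      Nat.choose (2 * n - 1) (2 * j - 1) * udCount (2 * j - 1) *
        AcountEq (n - j) (n + k + 1 - 2 * j) := by

  classical
  have hpart : AcountEq n (n + k) = ∑ j ∈ Finset.Icc 1 n,
      (((UDset (2 * n)).filter (fun σ => mmp1000 σ = n + k)).filter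
      (fun σ => ∃ i : Fin _, (i : ℕ) = 2 * j - 1 ∧ (σ i : ℕ) + 1 = 2 * n)).card := by
    rw [← Finset.card_biUnion]
    · unfold AcountEq
      congr 1
      ext σ
      simp only [Finset.mem_biUnion, Finset.mem_filter, Finset.mem_Icc]
      constructor
      · intro hσ
        have hu : IsUpDown σ := by simpa [UDset] using hσ.1
        let i := σ.symm ⟨2 * n - 1, by omega⟩
        have hi : (σ i : ℕ) + 1 = 2 * n := by simp [i]; omega
        have := max_pos n σ hu i hi
        have hlt := i.2
        exact ⟨((i : ℕ) + 1) / 2, by omega, hσ, i, by omega, hi⟩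
      · rintro ⟨j, -, hσ, -⟩
        exact hσ
    · intro a ha b hb hab
      rw [Function.onFun, Finset.disjoint_left]
      intro σ h1 h2
      simp only [Finset.mem_filter] at h1 h2
      obtain ⟨-, i, hi, hi'⟩ := h1
      obtain ⟨-, i2, hi2, hi2'⟩ := h2
      have : i = i2 := by
        apply σ.injective; ext; omega
      subst this
      simp at ha hb
      omega
  rw [hpart, ← Finset.sum_subset (Finset.Icc_subset_Icc_right hn)]
  · apply Finset.sum_congr rfl
    intro j hj
    rw [Finset.mem_Icc] at hj
    have := fiber_card (2 * n) (2 * j - 1) (2 * (n - j)) (n + k + 1 - 2 * j) (by omega) (by omega)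
    rw [show 2 * j - 1 + (n + k + 1 - 2 * j) = n + k by omega] at this
    exact this
  · intro j hj hj'
    rw [Finset.mem_Icc] at hj hj'
    by_cases hc : 2 * j - 1 ≤ n + k
    · have := fiber_card (2 * n) (2 * j - 1) (2 * (n - j)) (n + k + 1 - 2 * j)
        (by omega) (by omega)
      rw [show 2 * j - 1 + (n + k + 1 - 2 * j) = n + k by omega] at this
      rw [this]
      apply mul_eq_zero_of_right
      unfold cnt
      rw [Finset.card_eq_zero, Finset.filter_eq_empty_iff]
      intro σ hσ h
      have := mmp_ge (n - j) σ (by simpa [UDset] using hσ)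
      omega
    · rw [Finset.card_eq_zero, Finset.filter_eq_empty_iff]
      rintro σ hσ ⟨i, hi, hi'⟩
      have h1 := mmp_ge_max _ _ σ i hi hi'
      have h2 := (Finset.mem_filter.1 hσ).2
      omega
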